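/- Quasiconvexity of the generalized SOS program: let a, b : ℝʳ → ℝ[x₁,…,xₙ] be affine maps (a(d) = a₀ + ∑ᵢ dᵢ·aᵢ and b(d) = b₀ + ∑ᵢ dᵢ·bᵢ for fixed polynomials aᵢ, bᵢ). Suppose (d₁, t₁) and (d₂, t₂) are feasible, i.e., b(d₁), b(d₂), t₁·b(d₁) − a(d₁), and t₂·b(d₂) − a(d₂) are all SOS. Then for every θ ∈ [0,1], setting d_θ = θ·d₁ + (1−θ)·d₂ and t = max(t₁, t₂), the polynomials b(d_θ) and t·b(d_θ) − a(d_θ) are SOS. In other words, the sublevel sets { d : (d, t) is feasible } of the generalized SOS problem are convex and nested, so the problem is quasiconvex. -/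

import Mathlib

open MvPolynomial

/-- A polynomial `p ∈ ℝ[x₁,…,xₙ]` is a sum of squares (SOS) if there exist finitely many
polynomials `f₁,…,f_m` such that `p = ∑ᵢ fᵢ²`. -/
def IsSOS {n : ℕ} (p : MvPolynomial (Fin n) ℝ) : Prop :=
  ∃ (m : ℕ) (f : Fin m → MvPolynomial (Fin n) ℝ), p = ∑ i, (f i) ^ 2

namespace IsSOS

variable {n : ℕ} {p q : MvPolynomial (Fin n) ℝ}

theorem add (hp : IsSOS p) (hq : IsSOS q) : IsSOS (p + q) := by
  obtain ⟨k, f, rfl⟩ := hp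
  obtain ⟨l, g, rfl⟩ := hq
  exact ⟨k + l, Fin.append f g, by simp [Fin.sum_univ_add]⟩

theorem smul {c : ℝ} (hc : 0 ≤ c) (hp : IsSOS p) : IsSOS (c • p) := by
  obtain ⟨k, f, rfl⟩ := hp
  refine ⟨k, fun i => √c • f i, ?_⟩
  simp only [smul_pow, Real.sq_sqrt hc, Finset.smul_sum]

theorem smul_sub_mono {s t : ℝ} (hst : s ≤ t) (hq : IsSOS q) (h : IsSOS (s • q - p)) :
    IsSOS (t • q - p) := by
  have key : t • q - p = (s • q - p) + (t - s) • q := by module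
  rw [key]
  exact h.add (hq.smul (sub_nonneg.2 hst))

end IsSOS

theorem affine_apply_convex_combination {M : Type*} [AddCommGroup M] [Module ℝ M] {r : ℕ}
    (c : M) (v : Fin r → M) (d₁ d₂ : Fin r → ℝ) (θ : ℝ) :
    c + ∑ i, (θ • d₁ + (1 - θ) • d₂) i • v i =
      θ • (c + ∑ i, d₁ i • v i) + (1 - θ) • (c + ∑ i, d₂ i • v i) := by
  simp only [Pi.add_apply, Pi.smul_apply, add_smul, smul_eq_mul, mul_smul,
    Finset.sum_add_distrib, ← Finset.smul_sum]
  module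

theorem smul_convex_combination_sub {M : Type*} [AddCommGroup M] [Module ℝ M]
    (t θ : ℝ) (x₁ x₂ y₁ y₂ : M) :
    t • (θ • x₁ + (1 - θ) • x₂) - (θ • y₁ + (1 - θ) • y₂) =
      θ • (t • x₁ - y₁) + (1 - θ) • (t • x₂ - y₂) := by
  module

/-- Quasiconvexity of the generalized SOS program: with affine maps
`a(d) = a₀ + ∑ᵢ dᵢ·aᵢ` and `b(d) = b₀ + ∑ᵢ dᵢ·bᵢ`, if `(d₁, t₁)` and `(d₂, t₂)` are feasible
(i.e. `b(d₁)`, `b(d₂)`, `t₁·b(d₁) − a(d₁)`, `t₂·b(d₂) − a(d₂)` are SOS), then for every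
`θ ∈ [0,1]`, with `d_θ = θ·d₁ + (1−θ)·d₂` and `t = max(t₁, t₂)`, the polynomials `b(d_θ)` and
`t·b(d_θ) − a(d_θ)` are SOS. -/
theorem gsos_quasiconvex {n r : ℕ} (a₀ b₀ : MvPolynomial (Fin n) ℝ)
    (a b : Fin r → MvPolynomial (Fin n) ℝ)
    (A : (Fin r → ℝ) → MvPolynomial (Fin n) ℝ) (hA : ∀ d, A d = a₀ + ∑ i, d i • a i)
    (B : (Fin r → ℝ) → MvPolynomial (Fin n) ℝ) (hB : ∀ d, B d = b₀ + ∑ i, d i • b i)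
    (d₁ d₂ : Fin r → ℝ) (t₁ t₂ : ℝ)
    (hb₁ : IsSOS (B d₁)) (hb₂ : IsSOS (B d₂))
    (h₁ : IsSOS (t₁ • B d₁ - A d₁)) (h₂ : IsSOS (t₂ • B d₂ - A d₂))
    (θ : ℝ) (hθ : θ ∈ Set.Icc (0 : ℝ) 1) :
    IsSOS (B (θ • d₁ + (1 - θ) • d₂)) ∧
    IsSOS (max t₁ t₂ • B (θ • d₁ + (1 - θ) • d₂) - A (θ • d₁ + (1 - θ) • d₂)) := by
  obtain ⟨hθ₀, hθ₁⟩ := hθ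
  have hθ₁' : 0 ≤ 1 - θ := sub_nonneg.2 hθ₁
  have hAθ : A (θ • d₁ + (1 - θ) • d₂) = θ • A d₁ + (1 - θ) • A d₂ := by
    rw [hA, affine_apply_convex_combination, ← hA, ← hA]
  have hBθ : B (θ • d₁ + (1 - θ) • d₂) = θ • B d₁ + (1 - θ) • B d₂ := by
    rw [hB, affine_apply_convex_combination, ← hB, ← hB]
  rw [hAθ, hBθ]
  refine ⟨(hb₁.smul hθ₀).add (hb₂.smul hθ₁'), ?_⟩
  have e₁ := hb₁.smul_sub_mono (le_max_left t₁ t₂) h₁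
  have e₂ := hb₂.smul_sub_mono (le_max_right t₁ t₂) h₂
  rw [smul_convex_combination_sub]
  exact (e₁.smul hθ₀).add (e₂.smul hθ₁')
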